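/- Let V be a vertex operator algebra of CFT-type. If V is C_2-cofinite, then every weak V-module is an ℕ-gradable weak module; in particular, every irreducible weak V-module is an irreducible ordinary V-module (with finite-dimensional L(0)-graded pieces and lower-truncated grading). -/

import Mathlib

open scoped BigOperators

namespace VOAPaper

/-- Integer binomial coefficient `C(m, i)` for `m : ℤ`, `i : ℕ`. -/
def zchoose (m : ℤ) (i : ℕ) : ℤ :=
  if 0 ≤ m then ((m.toNat).choose i : ℤ)
  else (-1) ^ i * ((((i : ℤ) - m - 1).toNat).choose i : ℤ)

variable (V : Type) [AddCommGroup V] [Module ℂ V]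

/-- A vertex algebra structure on `V`: modes `u_n`, vacuum, truncation,
vacuum/creation axioms, and the Borcherds (Jacobi) identity. -/
structure VertexAlg where
  mode : V →ₗ[ℂ] ℤ → Module.End ℂ V
  vac : V
  trunc : ∀ u w : V, ∃ N : ℤ, ∀ n : ℤ, N ≤ n → mode u n w = 0
  vac_mode : ∀ (n : ℤ) (w : V), mode vac n w = if n = -1 then w else 0
  creation_neg_one : ∀ u : V, mode u (-1) vac = u
  creation_nonneg : ∀ (u : V) (n : ℤ), 0 ≤ n → mode u n vac = 0
  borcherds : ∀ (u v w : V) (p q m : ℤ),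
    (∑ᶠ i : ℕ, zchoose m i • mode (mode u (p + i) v) (m + q - i) w) =
    (∑ᶠ i : ℕ, ((-1 : ℤ) ^ i * zchoose p i) •
      (mode u (p + m - i) (mode v (q + i) w)
        - (p.negOnePow : ℤ) • mode v (p + q - i) (mode u (m + i) w)))

/-- A vertex operator algebra of CFT-type: a vertex algebra with conformal
vector `ω`, central charge `c`, an `L(0)`-grading `V = ⊕_{n ≥ 0} V_n` with
`V_0 = ℂ 1`, Virasoro relations, and the `L(-1)`-derivation property. -/
structure VOA extends VertexAlg V where
  ω : V
  c : ℂ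
  grading : ℤ → Submodule ℂ V
  internal : DirectSum.IsInternal grading
  neg_bot : ∀ n : ℤ, n < 0 → grading n = ⊥
  L0_eigen : ∀ (n : ℤ) (v : V), v ∈ grading n → mode ω 1 v = (n : ℂ) • v
  vac_grade : vac ∈ grading 0
  cft : grading 0 = Submodule.span ℂ {vac}
  ω_grade : ω ∈ grading 2
  virasoro : ∀ m n : ℤ,
    mode ω (m + 1) * mode ω (n + 1) - mode ω (n + 1) * mode ω (m + 1)
      = (m - n) • mode ω (m + n + 1)
        + (if m + n = 0 then ((m ^ 3 - m : ℂ) / 12) * c else 0) • (1 : Module.End ℂ V)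
  Lneg1_deriv : ∀ (u : V) (n : ℤ), mode (mode ω 0 u) n = (-n) • mode u (n - 1)

/-- A weak module for (the underlying vertex algebra of) `V`. -/
structure WeakMod (A : VertexAlg V) (M : Type) [AddCommGroup M] [Module ℂ M] where
  mmode : V →ₗ[ℂ] ℤ → Module.End ℂ M
  trunc : ∀ (v : V) (w : M), ∃ N : ℤ, ∀ n : ℤ, N ≤ n → mmode v n w = 0
  vac_mode : ∀ (n : ℤ) (w : M), mmode A.vac n w = if n = -1 then w else 0
  borcherds : ∀ (u v : V) (w : M) (p q m : ℤ),
    (∑ᶠ i : ℕ, zchoose m i • mmode (A.mode u (p + i) v) (m + q - i) w) =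
    (∑ᶠ i : ℕ, ((-1 : ℤ) ^ i * zchoose p i) •
      (mmode u (p + m - i) (mmode v (q + i) w)
        - (p.negOnePow : ℤ) • mmode v (p + q - i) (mmode u (m + i) w)))

/-- An ℕ-gradable weak module: a weak module with a compatible
lower-truncated grading `M = ⊕_{n ≥ 0} M(n)`. -/
structure NGradedMod (W : VOA V) (M : Type) [AddCommGroup M] [Module ℂ M]
    extends WeakMod V W.toVertexAlg M where
  mgrading : ℤ → Submodule ℂ M
  internal : DirectSum.IsInternal mgrading
  neg_bot : ∀ n : ℤ, n < 0 → mgrading n = ⊥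
  compat : ∀ (r : ℤ) (v : V), v ∈ W.grading r → ∀ (m n : ℤ), ∀ w ∈ mgrading n,
    mmode v m w ∈ mgrading (n + r - m - 1)

/-- Iterated application of modes: `applyModes [(u¹,n₁),…,(uʳ,nᵣ)] w = u¹_{n₁} ⋯ uʳ_{nᵣ} w`. -/
def applyModes (A : VertexAlg V) : List (V × ℤ) → V → V
  | [], w => w
  | p :: L, w => A.mode p.1 p.2 (applyModes A L w)

/-- Iterated application of module modes. -/
def applyModesM {M : Type} [AddCommGroup M] [Module ℂ M] {A : VertexAlg V}
    (Mod : WeakMod V A M) : List (V × ℤ) → M → M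
  | [], w => w
  | p :: L, w => Mod.mmode p.1 p.2 (applyModesM Mod L w)

/-- The subspace `C_n(V) = span{ u_{-n} v }`. -/
def Cspace (A : VertexAlg V) (n : ℕ) : Submodule ℂ V :=
  Submodule.span ℂ { x | ∃ u v : V, x = A.mode u (-(n : ℤ)) v }

/-- The subspace `C_1(V) = span{ u_{-1} v, L(-1)u : u, v ∈ V_+ }`. -/
def C1space (W : VOA V) : Submodule ℂ V :=
  Submodule.span ℂ
    ({ x | ∃ u v : V, (∃ r : ℤ, 0 < r ∧ u ∈ W.grading r) ∧
        (∃ r : ℤ, 0 < r ∧ v ∈ W.grading r) ∧ x = W.mode u (-1) v }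
      ∪ { x | ∃ u : V, (∃ r : ℤ, 0 < r ∧ u ∈ W.grading r) ∧ x = W.mode W.ω 0 u })

/-- A submodule invariant under all modes. -/
def Invariant {M : Type} [AddCommGroup M] [Module ℂ M] {A : VertexAlg V}
    (Mod : WeakMod V A M) (N : Submodule ℂ M) : Prop :=
  ∀ (v : V) (n : ℤ), ∀ w ∈ N, Mod.mmode v n w ∈ N

/-- Irreducibility of a weak module. -/
def IsIrreducibleMod {M : Type} [AddCommGroup M] [Module ℂ M] {A : VertexAlg V}
    (Mod : WeakMod V A M) : Prop :=
  (⊤ : Submodule ℂ M) ≠ ⊥ ∧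
    ∀ N : Submodule ℂ M, Invariant V Mod N → N = ⊥ ∨ N = ⊤

section Helpers

variable {V}

lemma zchoose_zero_right (m : ℤ) : zchoose m 0 = 1 := by
  simp [zchoose]

lemma zchoose_zero_left {i : ℕ} (hi : i ≠ 0) : zchoose 0 i = 0 := by
  simp [zchoose, Nat.choose_eq_zero_of_lt (Nat.pos_of_ne_zero hi)]

lemma zchoose_one_one : zchoose 1 1 = 1 := by
  simp [zchoose]

lemma zchoose_one_left {i : ℕ} (hi : 2 ≤ i) : zchoose 1 i = 0 := by
  simp [zchoose, Nat.choose_eq_zero_of_lt hi]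

lemma neg_one_pow_mul_zchoose_neg_one (i : ℕ) : (-1 : ℤ) ^ i * zchoose (-1) i = 1 := by
  have h : ((i : ℤ) - (-1) - 1).toNat = i := by omega
  rw [zchoose, if_neg (by norm_num), h, Nat.choose_self, ← mul_assoc, ← mul_pow]
  simp

lemma neg_one_pow_mul_zchoose_neg_two (i : ℕ) :
    (-1 : ℤ) ^ i * zchoose (-2) i = (i : ℤ) + 1 := by
  have h : ((i : ℤ) - (-2) - 1).toNat = i + 1 := by omega
  rw [zchoose, if_neg (by norm_num), h, Nat.choose_succ_self_right, ← mul_assoc, ← mul_pow]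
  simp

/-- A vertex algebra as a weak module over itself. -/
def VertexAlg.adjoint (A : VertexAlg V) : WeakMod V A V where
  mmode := A.mode
  trunc := A.trunc
  vac_mode := A.vac_mode
  borcherds := A.borcherds

namespace WeakMod

variable {A : VertexAlg V} {M : Type} [AddCommGroup M] [Module ℂ M] (Mod : WeakMod V A M)

lemma mmode_add (u v : V) (n : ℤ) (w : M) :
    Mod.mmode (u + v) n w = Mod.mmode u n w + Mod.mmode v n w := by
  rw [map_add, Pi.add_apply, LinearMap.add_apply]

lemma mmode_smul (c : ℂ) (v : V) (n : ℤ) (w : M) :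
    Mod.mmode (c • v) n w = c • Mod.mmode v n w := by
  rw [map_smul, Pi.smul_apply, LinearMap.smul_apply]

lemma mmode_zero (n : ℤ) (w : M) : Mod.mmode 0 n w = 0 := by
  rw [map_zero, Pi.zero_apply, LinearMap.zero_apply]

/-- The map `v ↦ v_n w`. -/
def evalMode (n : ℤ) (w : M) : V →ₗ[ℂ] M where
  toFun v := Mod.mmode v n w
  map_add' u v := Mod.mmode_add u v n w
  map_smul' c v := Mod.mmode_smul c v n w

@[simp] lemma evalMode_apply (n : ℤ) (w : M) (v : V) : Mod.evalMode n w v = Mod.mmode v n w := rfl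

/-- The commutator formula. -/
lemma commutator (u v : V) (m q : ℤ) (w : M) :
    Mod.mmode u m (Mod.mmode v q w) - Mod.mmode v q (Mod.mmode u m w)
      = ∑ᶠ i : ℕ, zchoose m i • Mod.mmode (A.mode u i v) (m + q - i) w := by
  have h := Mod.borcherds u v w 0 q m
  rw [finsum_eq_single (fun i : ℕ => ((-1 : ℤ) ^ i * zchoose 0 i) • _) 0
    (fun i hi => by rw [zchoose_zero_left hi, mul_zero, zero_smul])] at h
  simpa [zchoose_zero_right] using h.symm

/-- The associativity formula. -/
lemma mode_mode (u v : V) (p q : ℤ) (w : M) :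
    Mod.mmode (A.mode u p v) q w = ∑ᶠ i : ℕ, ((-1 : ℤ) ^ i * zchoose p i) •
      (Mod.mmode u (p - i) (Mod.mmode v (q + i) w)
        - (p.negOnePow : ℤ) • Mod.mmode v (p + q - i) (Mod.mmode u i w)) := by
  have h := Mod.borcherds u v w p q 0
  rw [finsum_eq_single (fun i : ℕ => zchoose 0 i • _) 0
    (fun i hi => by rw [zchoose_zero_left hi, zero_smul])] at h
  simpa [zchoose_zero_right] using h

lemma mode_neg_one_mode (u v : V) (q : ℤ) (w : M) :
    Mod.mmode (A.mode u (-1) v) q w = ∑ᶠ i : ℕ,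
      (Mod.mmode u (-1 - i) (Mod.mmode v (q + i) w)
        + Mod.mmode v (q - 1 - i) (Mod.mmode u i w)) := by
  rw [mode_mode]
  refine finsum_congr fun i => ?_
  rw [neg_one_pow_mul_zchoose_neg_one, one_smul, show (-1 : ℤ) + q - i = q - 1 - i by ring]
  simp

lemma mode_neg_two_mode (u v : V) (q : ℤ) (w : M) :
    Mod.mmode (A.mode u (-2) v) q w = ∑ᶠ i : ℕ, ((i : ℤ) + 1) •
      (Mod.mmode u (-2 - i) (Mod.mmode v (q + i) w)
        - Mod.mmode v (q - 2 - i) (Mod.mmode u i w)) := by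
  rw [mode_mode]
  refine finsum_congr fun i => ?_
  rw [neg_one_pow_mul_zchoose_neg_two, show (-2 : ℤ) + q - i = q - 2 - i by ring]
  simp [Int.negOnePow_even (-2) (by decide)]

lemma finite_support_nat {X : Type*} [Zero X] {f : ℕ → X} (N : ℤ)
    (hf : ∀ i : ℕ, N ≤ i → f i = 0) : f.HasFiniteSupport := by
  refine (Set.finite_lt_nat N.toNat).subset fun i hi => ?_
  by_contra hlt
  exact hi (hf i (by simp only [Set.mem_ofPred_eq] at hlt; omega))

lemma mode_neg_two_vac (u : V) (q : ℤ) (w : M) :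
    Mod.mmode (A.mode u (-2) A.vac) q w = (-q) • Mod.mmode u (q - 1) w := by
  rw [mode_neg_two_mode]
  simp only [Mod.vac_mode]
  rcases lt_trichotomy q 0 with hq | rfl | hq
  · rw [finsum_eq_single _ (-1 - q).toNat]
    · have h : (((-1 - q).toNat : ℕ) : ℤ) = -1 - q := by omega
      rw [h, if_pos (by ring), if_neg (by omega), sub_zero]
      congr 1
      · ring
      · ring_nf
    · intro i hi
      rw [if_neg (by omega), if_neg (by omega)]
      simp
  · rw [finsum_eq_zero_of_forall_eq_zero]
    · simp
    · intro i
      rw [if_neg (by omega), if_neg (by omega)]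
      simp
  · rw [finsum_eq_single _ (q - 1).toNat]
    · have h : (((q - 1).toNat : ℕ) : ℤ) = q - 1 := by omega
      rw [h, if_neg (by omega), if_pos (by ring), map_zero, zero_sub, smul_neg, neg_smul]
      congr 2
      ring
    · intro i hi
      rw [if_neg (by omega), if_neg (by omega)]
      simp

end WeakMod

namespace VOA

variable (W : VOA V)

lemma omega_zero (u : V) : W.mode W.ω 0 u = W.mode u (-2) W.vac := by
  have h := congrArg (fun f => f W.vac) (W.Lneg1_deriv u (-1))
  simpa [W.creation_neg_one] using h

variable {M : Type} [AddCommGroup M] [Module ℂ M] (Mod : WeakMod V W.toVertexAlg M)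

/-- `[L(0), v_n] = (wt v - n - 1) v_n` on every weak module. -/
lemma L0_mmode {r : ℤ} {v : V} (hv : v ∈ W.grading r) (n : ℤ) (w : M) :
    Mod.mmode W.ω 1 (Mod.mmode v n w)
      = Mod.mmode v n (Mod.mmode W.ω 1 w) + ((r - n - 1 : ℤ) : ℂ) • Mod.mmode v n w := by
  have h := Mod.commutator W.ω v 1 n w
  rw [finsum_eq_sum_of_support_subset (s := Finset.range 2), Finset.sum_range_succ,
    Finset.sum_range_one, zchoose_zero_right, zchoose_one_one] at h
  · rw [sub_eq_iff_eq_add'] at h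
    rw [h]
    congr 1
    simp only [Nat.cast_zero, Nat.cast_one, one_smul]
    rw [omega_zero, Mod.mode_neg_two_vac, W.L0_eigen r v hv, Mod.mmode_smul,
      show (1 : ℤ) + n - 0 - 1 = n by ring, show (1 : ℤ) + n - 1 = n by ring,
      ← Int.cast_smul_eq_zsmul ℂ, ← add_smul]
    congr 1
    push_cast
    ring
  · intro i hi
    rw [Finset.coe_range, Set.mem_Iio]
    by_contra hlt
    refine hi ?_
    change zchoose 1 i • _ = 0
    rw [zchoose_one_left (by omega), zero_smul]

/-- The grading comes with a family of projections. -/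
lemma exists_proj : ∃ π : ℤ → V →ₗ[ℂ] V,
    (∀ r v, v ∈ W.grading r → π r v = v) ∧
    (∀ r s v, v ∈ W.grading r → s ≠ r → π s v = 0) ∧
    (∀ r v, π r v ∈ W.grading r) ∧
    (∀ v, ∃ K : Finset ℤ, ∀ r ∉ K, π r v = 0) ∧
    (∀ v, (∀ r, π r v = 0) → v = 0) := by
  classical
  let _ := W.internal.chooseDecomposition
  refine ⟨fun r => (W.grading r).subtype ∘ₗ DirectSum.component ℂ ℤ _ r ∘ₗ
    (DirectSum.decomposeLinearEquiv W.grading).toLinearMap, ?_, ?_, ?_, ?_, ?_⟩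
  · intro r v hv
    exact DirectSum.decompose_of_mem_same W.grading hv
  · intro r s v hv hs
    exact DirectSum.decompose_of_mem_ne W.grading hv hs.symm
  · intro r v
    exact Submodule.coe_mem _
  · intro v
    refine ⟨(DirectSum.decompose W.grading v).support, fun r hr => ?_⟩
    rw [DFinsupp.notMem_support_iff] at hr
    exact congrArg Subtype.val hr
  · intro v h
    apply (DirectSum.decompose W.grading).injective
    rw [DirectSum.decompose_zero]
    ext r
    exact h r

lemma homogeneous_induction {p : V → Prop} (h0 : p 0) (hadd : ∀ u v, p u → p v → p (u + v))
    (hom : ∀ r, ∀ v ∈ W.grading r, p v) (v : V) : p v := by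
  have hv : v ∈ ⨆ r, W.grading r := by
    rw [W.internal.submodule_iSup_eq_top]; trivial
  exact Submodule.iSup_induction W.grading (motive := p) hv hom h0 hadd

/-- The grading of `V` is the eigenspace decomposition of `L(0)`. -/
lemma mem_grading_of_L0 {n : ℤ} {v : V} (hv : W.mode W.ω 1 v = (n : ℂ) • v) :
    v ∈ W.grading n := by
  obtain ⟨π, h1, h2, h3, -, h5⟩ := W.exists_proj
  have key : ∀ (r : ℤ) (x : V), π r (W.mode W.ω 1 x) = (r : ℂ) • π r x := by
    intro r
    refine W.homogeneous_induction (by simp) (fun u v hu hv => by simp [hu, hv]) ?_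
    intro s x hx
    rw [W.L0_eigen s x hx, map_smul]
    by_cases hs : r = s
    · rw [hs]
    · rw [h2 s r x hx hs, smul_zero, smul_zero]
  have hz : v - π n v = 0 := by
    refine h5 _ fun r => ?_
    rw [map_sub]
    by_cases hr : r = n
    · subst hr
      rw [h1 r _ (h3 r v), sub_self]
    · rw [h2 n r _ (h3 n v) hr, sub_zero]
      have hk := key r v
      rw [hv, map_smul, ← sub_eq_zero, ← sub_smul] at hk
      refine (smul_eq_zero.1 hk).resolve_left ?_
      rw [← Ne, sub_ne_zero]
      exact_mod_cast Ne.symm hr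
  rw [sub_eq_zero.1 hz]
  exact h3 n v

lemma mode_mem_grading {i j : ℤ} {a b : V} (ha : a ∈ W.grading i) (hb : b ∈ W.grading j)
    (n : ℤ) : W.mode a n b ∈ W.grading (i + j - n - 1) := by
  apply W.mem_grading_of_L0
  have h := W.L0_mmode W.toVertexAlg.adjoint ha n b
  change W.mode W.ω 1 (W.mode a n b) = W.mode a n (W.mode W.ω 1 b) + _ • W.mode a n b at h
  rw [h, W.L0_eigen j b hb, map_smul, ← add_smul]
  congr 1
  push_cast
  ring

/-- The weight `r` part of `C₂(V)`. -/
def C2graded (r : ℤ) : Submodule ℂ V :=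
  Submodule.span ℂ {x | ∃ i j : ℤ, ∃ a ∈ W.grading i, ∃ b ∈ W.grading j,
    i + j + 1 = r ∧ x = W.mode a (-2) b}

/-- A finite homogeneous generating set of `V` modulo `C₂(V)` and the vacuum. -/
lemma exists_generators (h : FiniteDimensional ℂ (V ⧸ Cspace V W.toVertexAlg 2)) :
    ∃ (ι : Type) (_ : Finite ι) (u : ι → V) (wt : ι → ℤ),
      (∀ k, u k ∈ W.grading (wt k)) ∧ (∀ k, 1 ≤ wt k) ∧
      ∀ r : ℤ, 1 ≤ r → ∀ v ∈ W.grading r,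
        v ∈ Submodule.span ℂ {x | ∃ k, wt k = r ∧ u k = x} ⊔ W.C2graded r := by
  classical
  obtain ⟨π, h1, h2, h3, h4, -⟩ := W.exists_proj
  have hC2 : ∀ r : ℤ, ∀ x ∈ Cspace V W.toVertexAlg 2, π r x ∈ W.C2graded r := by
    intro r x hx
    induction hx using Submodule.span_induction with
    | zero => simp
    | add x y _ _ hx hy => rw [map_add]; exact add_mem hx hy
    | smul c x _ hx => rw [map_smul]; exact Submodule.smul_mem _ _ hx
    | mem x hx =>
      obtain ⟨a, b, rfl⟩ := hx
      revert b
      refine W.homogeneous_induction (p := fun a => ∀ b, π r (W.mode a (-(2 : ℕ) : ℤ) b) ∈ _)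
        ?_ ?_ ?_ a
      · intro b; simp
      · intro a a' ha ha' b
        rw [map_add, Pi.add_apply, LinearMap.add_apply, map_add]
        exact add_mem (ha b) (ha' b)
      · intro i a ha
        refine W.homogeneous_induction (by simp) ?_ ?_
        · intro b b' hb hb'
          rw [map_add, map_add]
          exact add_mem hb hb'
        · intro j b hb
          have hm := W.mode_mem_grading ha hb (-2)
          by_cases hr : r = i + j - (-2) - 1
          · subst hr
            change π _ (W.mode a (-2) b) ∈ _
            rw [h1 _ _ hm]
            exact Submodule.subset_span ⟨i, j, a, ha, b, hb, by ring, rfl⟩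
          · change π _ (W.mode a (-2) b) ∈ _
            rw [h2 _ _ _ hm hr]
            exact zero_mem _
  obtain ⟨S, hS⟩ := (Module.finite_def.1 h)
  choose f hf using (Cspace V W.toVertexAlg 2).mkQ_surjective
  set T : Finset V := S.image f
  choose K hK using h4
  set B : Finset ℤ := T.biUnion K
  refine ⟨{p : T × B // 1 ≤ (p.2 : ℤ)}, inferInstance, fun p => π p.1.2 p.1.1,
    fun p => p.1.2, fun p => h3 _ _, fun p => p.2, ?_⟩
  intro r hr v hv
  have hspan : ∀ x : V, ∃ t ∈ Submodule.span ℂ (T : Set V),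
      x - t ∈ Cspace V W.toVertexAlg 2 := by
    intro x
    have hx : (Cspace V W.toVertexAlg 2).mkQ x ∈ Submodule.span ℂ (S : Set _) := by
      rw [hS]; trivial
    have hTS : (S : Set _) = (Cspace V W.toVertexAlg 2).mkQ '' (T : Set V) := by
      ext y
      simp [T, -Submodule.mkQ_apply, hf]
    rw [hTS, Submodule.span_image] at hx
    obtain ⟨t, ht, htx⟩ := hx
    exact ⟨t, ht, (Submodule.Quotient.eq _).1 htx.symm⟩
  obtain ⟨t, ht, hvt⟩ := hspan v
  have hdec : v = π r t + π r (v - t) := by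
    rw [map_sub, h1 r v hv]; abel
  rw [hdec]
  refine Submodule.add_mem_sup ?_ (hC2 r _ hvt)
  clear hdec hvt
  induction ht using Submodule.span_induction with
  | zero => simp
  | add x y _ _ hx hy => rw [map_add]; exact add_mem hx hy
  | smul c x _ hx => rw [map_smul]; exact Submodule.smul_mem _ _ hx
  | mem x hx =>
    by_cases hrB : r ∈ B
    · exact Submodule.subset_span ⟨⟨(⟨x, hx⟩, ⟨r, hrB⟩), hr⟩, rfl, rfl⟩
    · rw [hK x r (fun hk => hrB (Finset.mem_biUnion.2 ⟨x, hx, hk⟩))]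
      exact zero_mem _

end VOA

/-- `Gen W Mod w s d x`: `x` is a product of homogeneous modes applied to `w`, of total weight `s`
and total degree `d`. -/
inductive Gen (W : VOA V) {M : Type} [AddCommGroup M] [Module ℂ M]
    (Mod : WeakMod V W.toVertexAlg M) (w : M) : ℤ → ℤ → M → Prop
  | base : Gen W Mod w 0 0 w
  | step {s d : ℤ} {x : M} (r : ℤ) (v : V) (hv : v ∈ W.grading r) (n : ℤ)
      (hx : Gen W Mod w s d x) : Gen W Mod w (s + r) (d + r - n - 1) (Mod.mmode v n x)

section Filtration

variable (W : VOA V) {M : Type} [AddCommGroup M] [Module ℂ M]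
  (Mod : WeakMod V W.toVertexAlg M) (w : M)

/-- The span of the products of total weight at most `s` and degree `d` applied to `w`. -/
def filt (s d : ℤ) : Submodule ℂ M :=
  Submodule.span ℂ {x | ∃ s' ≤ s, Gen W Mod w s' d x}

variable {W Mod w}

lemma filt_mono {s s' d d' : ℤ} {x : M} (hx : x ∈ filt W Mod w s d) (hs : s ≤ s') (hd : d = d') :
    x ∈ filt W Mod w s' d' := by
  subst hd
  refine Submodule.span_mono ?_ hx
  rintro y ⟨t, ht, hy⟩
  exact ⟨t, ht.trans hs, hy⟩

lemma mmode_mem_filt {r : ℤ} {v : V} (hv : v ∈ W.grading r) (n : ℤ) {s d : ℤ} {x : M}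
    (hx : x ∈ filt W Mod w s d) : Mod.mmode v n x ∈ filt W Mod w (s + r) (d + r - n - 1) := by
  induction hx using Submodule.span_induction with
  | zero => simp
  | add x y _ _ hx hy => rw [map_add]; exact add_mem hx hy
  | smul c x _ hx => rw [map_smul]; exact Submodule.smul_mem _ _ hx
  | mem x hx =>
    obtain ⟨t, ht, hx⟩ := hx
    exact Submodule.subset_span ⟨t + r, by omega, hx.step r v hv n⟩

lemma Gen.nonneg_or_eq_zero {s d : ℤ} {x : M} (hx : Gen W Mod w s d x) : 0 ≤ s ∨ x = 0 := by
  induction hx with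
  | base => exact Or.inl le_rfl
  | @step s d x r v hv n hx ih =>
    rcases ih with ih | rfl
    · rcases lt_or_ge r 0 with hr | hr
      · rw [W.neg_bot r hr, Submodule.mem_bot] at hv
        rw [hv, Mod.mmode_zero]
        exact Or.inr rfl
      · exact Or.inl (by omega)
    · exact Or.inr (map_zero _)

lemma filt_eq_bot {s d : ℤ} (hs : s < 0) : filt W Mod w s d = ⊥ := by
  rw [filt, Submodule.span_eq_bot]
  rintro x ⟨t, ht, hx⟩
  exact hx.nonneg_or_eq_zero.resolve_left (by omega)

lemma finsum_mem_submodule {P : Submodule ℂ M} {f : ℕ → M} (hf : ∀ i, f i ∈ P) :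
    ∑ᶠ i, f i ∈ P :=
  finsum_induction (· ∈ P) P.zero_mem (fun _ _ => P.add_mem) hf

lemma commutator_mem_filt {r q : ℤ} {a b : V} (ha : a ∈ W.grading r) (hb : b ∈ W.grading q)
    (m n : ℤ) {s d : ℤ} {x : M} (hx : x ∈ filt W Mod w s d) :
    Mod.mmode a m (Mod.mmode b n x) - Mod.mmode b n (Mod.mmode a m x)
      ∈ filt W Mod w (s + r + q - 1) (d + r + q - m - n - 2) := by
  rw [Mod.commutator]
  refine finsum_mem_submodule fun i => zsmul_mem ?_ _
  exact filt_mono (mmode_mem_filt (W.mode_mem_grading ha hb i) (m + n - i) hx)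
    (by omega) (by omega)

lemma mode_neg_two_mem_filt {r q : ℤ} {a b : V} (ha : a ∈ W.grading r) (hb : b ∈ W.grading q)
    (n : ℤ) {s d : ℤ} {x : M} (hx : x ∈ filt W Mod w s d) :
    Mod.mmode (W.mode a (-2) b) n x ∈ filt W Mod w (s + r + q) (d + r + q - n) := by
  rw [Mod.mode_neg_two_mode]
  refine finsum_mem_submodule fun i => zsmul_mem (sub_mem ?_ ?_) _
  · exact filt_mono (mmode_mem_filt ha (-2 - i) (mmode_mem_filt hb (n + i) hx))
      (by omega) (by omega)
  · exact filt_mono (mmode_mem_filt hb (n - 2 - i) (mmode_mem_filt ha i hx))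
      (by omega) (by omega)

lemma C2graded_mem_filt {r : ℤ} {c : V} (hc : c ∈ W.C2graded r) (n : ℤ) {s d : ℤ} {x : M}
    (hx : x ∈ filt W Mod w s d) :
    Mod.mmode c n x ∈ filt W Mod w (s + r - 1) (d + r - n - 1) := by
  induction hc using Submodule.span_induction with
  | zero => rw [Mod.mmode_zero]; exact zero_mem _
  | add a b _ _ ha hb => rw [Mod.mmode_add]; exact add_mem ha hb
  | smul c a _ ha => rw [Mod.mmode_smul]; exact Submodule.smul_mem _ _ ha
  | mem a ha =>
    obtain ⟨i, j, a, ha, b, hb, hij, rfl⟩ := ha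
    exact filt_mono (mode_neg_two_mem_filt ha hb n hx) (by omega) (by omega)

end Filtration

section Words

variable {W : VOA V} {M : Type} [AddCommGroup M] [Module ℂ M]
  (Mod : WeakMod V W.toVertexAlg M) (w : M) {ι : Type} (u : ι → V) (wt : ι → ℤ)

/-- The product of the modes `(u k)_n`, `(k, n) ∈ L`, applied to `w`. -/
def word (L : List (ι × ℤ)) : M := L.foldr (fun p y => Mod.mmode (u p.1) p.2 y) w

/-- The total weight of a word. -/
def wordWt (L : List (ι × ℤ)) : ℤ := (L.map fun p => wt p.1).sum

/-- The total degree of a word. -/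
def wordDeg (L : List (ι × ℤ)) : ℤ := (L.map fun p => wt p.1 - p.2 - 1).sum

@[simp] lemma word_cons (p : ι × ℤ) (L : List (ι × ℤ)) :
    word Mod w u (p :: L) = Mod.mmode (u p.1) p.2 (word Mod w u L) := rfl

@[simp] lemma wordWt_cons (p : ι × ℤ) (L : List (ι × ℤ)) :
    wordWt wt (p :: L) = wt p.1 + wordWt wt L := by simp [wordWt]

@[simp] lemma wordDeg_cons (p : ι × ℤ) (L : List (ι × ℤ)) :
    wordDeg wt (p :: L) = wt p.1 - p.2 - 1 + wordDeg wt L := by simp [wordDeg]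

lemma wordWt_perm {L L' : List (ι × ℤ)} (h : L.Perm L') : wordWt wt L = wordWt wt L' :=
  (h.map _).sum_eq

lemma wordDeg_perm {L L' : List (ι × ℤ)} (h : L.Perm L') : wordDeg wt L = wordDeg wt L' :=
  (h.map _).sum_eq

lemma wordDeg_eq (L : List (ι × ℤ)) :
    wordDeg wt L = wordWt wt L - (L.map Prod.snd).sum - L.length := by
  induction L with
  | nil => simp [wordDeg, wordWt]
  | cons p L ih => simp [ih]; ring

variable {Mod w u wt}

lemma word_mem_filt (hu : ∀ k, u k ∈ W.grading (wt k)) (L : List (ι × ℤ)) :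
    word Mod w u L ∈ filt W Mod w (wordWt wt L) (wordDeg wt L) := by
  induction L with
  | nil => exact Submodule.subset_span ⟨0, le_rfl, Gen.base⟩
  | cons p L ih =>
    rw [word_cons, wordWt_cons, wordDeg_cons]
    exact filt_mono (mmode_mem_filt (hu p.1) p.2 ih) (by omega) (by omega)

lemma word_perm (hu : ∀ k, u k ∈ W.grading (wt k)) {L L' : List (ι × ℤ)} (h : L.Perm L') :
    word Mod w u L - word Mod w u L' ∈ filt W Mod w (wordWt wt L - 1) (wordDeg wt L) := by
  induction h with
  | nil => simp
  | cons p _ ih =>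
    rw [word_cons, word_cons, ← map_sub, wordWt_cons, wordDeg_cons]
    exact filt_mono (mmode_mem_filt (hu p.1) p.2 ih) (by omega) (by omega)
  | swap p q L =>
    simp only [word_cons, wordWt_cons, wordDeg_cons]
    exact filt_mono (commutator_mem_filt (hu q.1) (hu p.1) q.2 p.2 (word_mem_filt hu L))
      (by omega) (by omega)
  | @trans L L' L'' h₁ h₂ ih₁ ih₂ =>
    rw [← sub_add_sub_cancel _ (word Mod w u L')]
    rw [← wordWt_perm wt h₁, ← wordDeg_perm wt h₁] at ih₂
    exact add_mem ih₁ ih₂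

lemma word_mem_of_perm (hu : ∀ k, u k ∈ W.grading (wt k)) {P : Submodule ℂ M} {s d : ℤ}
    (hP : filt W Mod w (s - 1) d ≤ P) {L L' : List (ι × ℤ)} (h : L.Perm L')
    (hs : wordWt wt L = s) (hd : wordDeg wt L = d) (hL' : word Mod w u L' ∈ P) :
    word Mod w u L ∈ P := by
  have := word_perm (Mod := Mod) (w := w) hu h
  rw [hs, hd] at this
  rw [← sub_add_cancel (word Mod w u L) (word Mod w u L')]
  exact add_mem (hP this) hL'

/-- A mode of an arbitrary homogeneous vector applied to a word is, up to terms of lower weight, a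
combination of words with one more letter. -/
lemma mmode_word_mem (hu : ∀ k, u k ∈ W.grading (wt k))
    (hspan : ∀ r : ℤ, 1 ≤ r → ∀ v ∈ W.grading r,
      v ∈ Submodule.span ℂ {x | ∃ k, wt k = r ∧ u k = x} ⊔ W.C2graded r)
    {P : Submodule ℂ M} {r : ℤ} (hr : 1 ≤ r) {v : V} (hv : v ∈ W.grading r) (n : ℤ)
    (L : List (ι × ℤ))
    (hP : filt W Mod w (wordWt wt L + r - 1) (wordDeg wt L + r - n - 1) ≤ P)
    (hw : ∀ k, wt k = r → word Mod w u ((k, n) :: L) ∈ P) :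
    Mod.mmode v n (word Mod w u L) ∈ P := by
  obtain ⟨a, ha, c, hc, rfl⟩ := Submodule.mem_sup.1 (hspan r hr v hv)
  rw [Mod.mmode_add]
  refine add_mem ?_ (hP (C2graded_mem_filt hc n (word_mem_filt hu L)))
  have : Submodule.span ℂ {x | ∃ k, wt k = r ∧ u k = x}
      ≤ P.comap (Mod.evalMode n (word Mod w u L)) := by
    rw [Submodule.span_le]
    rintro _ ⟨k, hk, rfl⟩
    exact hw k hk
  exact this ha

lemma exists_perm_of_not_nodup {α β : Type*} (f : α → β) {L : List α} (h : ¬ (L.map f).Nodup) :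
    ∃ p q L', L.Perm (p :: q :: L') ∧ f p = f q := by
  induction L with
  | nil => simp at h
  | cons a L ih =>
    by_cases ha : f a ∈ L.map f
    · obtain ⟨q, hq, hqa⟩ := List.mem_map.1 ha
      obtain ⟨L₁, L₂, rfl⟩ := List.append_of_mem hq
      exact ⟨a, q, L₁ ++ L₂, List.perm_middle.cons a, hqa.symm⟩
    · have hL : ¬ (L.map f).Nodup := fun hL => h (by
        rw [List.map_cons, List.nodup_cons]; exact ⟨ha, hL⟩)
      obtain ⟨p, q, L', hp, hpq⟩ := ih hL
      exact ⟨p, q, a :: L', (hp.cons a).trans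
        ((List.Perm.swap p a _).trans ((List.Perm.swap q a _).cons p)), hpq⟩

lemma sum_sq_le_sq_sum {L : List ℤ} (h : ∀ x ∈ L, 0 ≤ x) :
    (L.map (· ^ 2)).sum ≤ L.sum ^ 2 := by
  induction L with
  | nil => simp
  | cons a L ih =>
    have h1 := ih fun x hx => h x (List.mem_cons_of_mem _ hx)
    have h2 : 0 ≤ L.sum := List.sum_nonneg fun x hx => h x (List.mem_cons_of_mem _ hx)
    have h3 : 0 ≤ a := h a List.mem_cons_self
    simp only [List.map_cons, List.sum_cons]
    nlinarith [mul_nonneg h2 h3]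

lemma mem_of_finsum_mem {P : Submodule ℂ M} {f : ℕ → M} (hf : f.HasFiniteSupport)
    (hsum : ∑ᶠ i, f i ∈ P) (i₀ : ℕ) (h : ∀ i ≠ i₀, f i ∈ P) : f i₀ ∈ P := by
  classical
  rw [finsum_eq_sum_of_support_subset f (s := insert i₀ hf.toFinset)
    (by intro i hi; simp only [Finset.coe_insert, Set.mem_insert_iff]
        right; exact hf.mem_toFinset.2 hi),
    ← Finset.add_sum_erase _ _ (Finset.mem_insert_self _ _)] at hsum
  refine (Submodule.add_mem_iff_left P (Submodule.sum_mem P fun i hi => ?_)).1 hsum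
  exact h i (Finset.ne_of_mem_erase hi)

/-- The square spread of the indices of a word. -/
def spread (N : ℤ) (L : List (ι × ℤ)) : ℤ := (L.map fun p => (N - 1 - p.2) ^ 2).sum

lemma spread_perm (N : ℤ) {L L' : List (ι × ℤ)} (h : L.Perm L') : spread N L = spread N L' :=
  (h.map _).sum_eq

lemma spread_le {N s d : ℤ} {L : List (ι × ℤ)} (hN : ∀ p ∈ L, p.2 < N)
    (hs : wordWt wt L = s) (hd : wordDeg wt L = d) :
    spread N L ≤ (L.length * (N - 1) - (s - d - L.length)) ^ 2 := by
  have h1 := sum_sq_le_sq_sum (L := L.map fun p => N - 1 - p.2) (by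
    intro x hx
    obtain ⟨p, hp, rfl⟩ := List.mem_map.1 hx
    have := hN p hp
    omega)
  have h2 : (L.map fun p => N - 1 - p.2).sum = L.length * (N - 1) - (L.map Prod.snd).sum := by
    clear hN hs hd h1
    induction L with
    | nil => simp
    | cons p L ih => simp [ih]; ring
  rw [wordDeg_eq, hs] at hd
  rw [List.map_map, h2] at h1
  rw [show s - d - L.length = (L.map Prod.snd).sum by omega]
  exact h1

/-- Words with an index at which all letters kill `w` are of lower weight. -/
lemma word_mem_of_le (hu : ∀ k, u k ∈ W.grading (wt k)) {N : ℤ}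
    (hN : ∀ k, ∀ n : ℤ, N ≤ n → Mod.mmode (u k) n w = 0) {P : Submodule ℂ M} {s d : ℤ}
    (hP : filt W Mod w (s - 1) d ≤ P) {L : List (ι × ℤ)}
    (hs : wordWt wt L = s) (hd : wordDeg wt L = d) {p : ι × ℤ} (hp : p ∈ L) (hpN : N ≤ p.2) :
    word Mod w u L ∈ P := by
  obtain ⟨L₁, L₂, rfl⟩ := List.append_of_mem hp
  have hperm : (L₁ ++ p :: L₂).Perm ((L₁ ++ L₂) ++ [p]) :=
    List.perm_middle.trans (List.perm_append_singleton p _).symm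
  refine word_mem_of_perm hu hP hperm hs hd ?_
  have hz : ∀ L : List (ι × ℤ), word Mod w u (L ++ [p]) = 0 := by
    intro L
    induction L with
    | nil => simpa [word] using hN p.1 p.2 hpN
    | cons q L ih => rw [List.cons_append, word_cons, ih, map_zero]
  rw [hz]
  exact zero_mem _

/-- Rewriting a word, up to lower weight, into words with distinct bounded indices. -/
lemma word_mem_of_normal (hu : ∀ k, u k ∈ W.grading (wt k)) (hwt : ∀ k, 1 ≤ wt k)
    (hspan : ∀ r : ℤ, 1 ≤ r → ∀ v ∈ W.grading r,
      v ∈ Submodule.span ℂ {x | ∃ k, wt k = r ∧ u k = x} ⊔ W.C2graded r)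
    {N : ℤ} (hN : ∀ k, ∀ n : ℤ, N ≤ n → Mod.mmode (u k) n w = 0)
    {P : Submodule ℂ M} {s d : ℤ} (hP : filt W Mod w (s - 1) d ≤ P)
    (hnormal : ∀ L : List (ι × ℤ), wordDeg wt L = d → (∀ p ∈ L, p.2 < N) →
      (L.map Prod.snd).Nodup → word Mod w u L ∈ P)
    (L : List (ι × ℤ)) (hs : wordWt wt L = s) (hd : wordDeg wt L = d) :
    word Mod w u L ∈ P := by
  induction hl : L.length using Nat.strong_induction_on generalizing L with
  | _ l ihl =>
  induction hm : ((l * (N - 1) - (s - d - l)) ^ 2 - spread N L).toNat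
    using Nat.strong_induction_on generalizing L with
  | _ m ihm =>
  by_cases hlt : ∀ p ∈ L, p.2 < N
  swap
  · push Not at hlt
    obtain ⟨p, hp, hpN⟩ := hlt
    exact word_mem_of_le hu hN hP hs hd hp hpN
  by_cases hnd : (L.map Prod.snd).Nodup
  · exact hnormal L hd hlt hnd
  obtain ⟨⟨k, n⟩, ⟨k', n'⟩, L', hperm, hn⟩ := exists_perm_of_not_nodup _ hnd
  obtain rfl : n = n' := hn
  have hl' := hperm.length_eq
  rw [hl, List.length_cons, List.length_cons] at hl'
  have hs' := hs
  rw [wordWt_perm wt hperm, wordWt_cons, wordWt_cons] at hs'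
  have hd' := hd
  rw [wordDeg_perm wt hperm, wordDeg_cons, wordDeg_cons] at hd'
  dsimp only at hs' hd'
  have hspr : ∀ L₂ : List (ι × ℤ), wordWt wt L₂ = s → wordDeg wt L₂ = d → L₂.length = l →
      spread N L < spread N L₂ → word Mod w u L₂ ∈ P := by
    intro L₂ hs₂ hd₂ hl₂ hlt₂
    by_cases h : ∀ p ∈ L₂, p.2 < N
    · have h1 := spread_le h hs₂ hd₂
      rw [hl₂] at h1
      refine ihm _ ?_ L₂ hs₂ hd₂ hl₂ rfl
      omega
    · push Not at h
      obtain ⟨p, hp, hpN⟩ := h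
      exact word_mem_of_le hu hN hP hs₂ hd₂ hp hpN
  have hsL : spread N L = (N - 1 - n) ^ 2 + ((N - 1 - n) ^ 2 + spread N L') := by
    rw [spread_perm N hperm]; simp [spread]
  have hpair : ∀ i j : ℤ, i + j = 2 * n → i ≠ n →
      Mod.mmode (u k) i (Mod.mmode (u k') j (word Mod w u L')) ∈ P ∧
      Mod.mmode (u k') j (Mod.mmode (u k) i (word Mod w u L')) ∈ P := by
    intro i j hij hi
    have hsq : (N - 1 - n) ^ 2 + (N - 1 - n) ^ 2 < (N - 1 - i) ^ 2 + (N - 1 - j) ^ 2 := by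
      obtain rfl : j = 2 * n - i := by omega
      have : 0 < (i - n) ^ 2 := by
        have : i - n ≠ 0 := sub_ne_zero.2 hi
        positivity
      nlinarith
    constructor
    · refine hspr ((k, i) :: (k', j) :: L') ?_ ?_ ?_ ?_
      · simp only [wordWt_cons]; omega
      · simp only [wordDeg_cons]; omega
      · simp only [List.length_cons]; omega
      · rw [hsL]; simp only [spread, List.map_cons, List.sum_cons]; omega
    · refine hspr ((k', j) :: (k, i) :: L') ?_ ?_ ?_ ?_
      · simp only [wordWt_cons]; omega
      · simp only [wordDeg_cons]; omega
      · simp only [List.length_cons]; omega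
      · rw [hsL]; simp only [spread, List.map_cons, List.sum_cons]; omega
  have hsum := Mod.mode_neg_one_mode (u k) (u k') (2 * n + 1) (word Mod w u L')
  have hmem : Mod.mmode (W.mode (u k) (-1) (u k')) (2 * n + 1) (word Mod w u L') ∈ P := by
    have hk := hwt k
    have hk' := hwt k'
    refine mmode_word_mem hu hspan (r := wt k + wt k') (by omega) ?_ _ L' ?_ ?_
    · have := W.mode_mem_grading (hu k) (hu k') (-1)
      rwa [show wt k + wt k' - (-1) - 1 = wt k + wt k' by ring] at this
    · exact fun x hx => hP (filt_mono hx (by omega) (by omega))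
    · intro k'' hk''
      refine ihl (L'.length + 1) (by omega) ((k'', 2 * n + 1) :: L') ?_ ?_ (by simp)
      · rw [wordWt_cons]; dsimp only; omega
      · rw [wordDeg_cons]; dsimp only; omega
  have hfin : (fun i : ℕ =>
      Mod.mmode (u k) (-1 - i) (Mod.mmode (u k') (2 * n + 1 + i) (word Mod w u L'))
        + Mod.mmode (u k') (2 * n + 1 - 1 - i)
          (Mod.mmode (u k) i (word Mod w u L'))).HasFiniteSupport := by
    obtain ⟨N₁, hN₁⟩ := Mod.trunc (u k) (word Mod w u L')
    obtain ⟨N₂, hN₂⟩ := Mod.trunc (u k') (word Mod w u L')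
    refine WeakMod.finite_support_nat (max N₁ (N₂ - 2 * n - 1)) fun i hi => ?_
    rw [hN₁ i (by omega), hN₂ _ (by omega), map_zero, map_zero, add_zero]
  rw [hsum] at hmem
  rcases lt_or_ge n 0 with hneg | hpos
  · have h0 := mem_of_finsum_mem hfin hmem (-1 - n).toNat (fun i hi =>
      add_mem (hpair _ _ (by ring) (by omega)).1 (hpair _ _ (by ring) (by omega)).2)
    have hc : (((-1 - n).toNat : ℕ) : ℤ) = -1 - n := by omega
    rw [hc, Submodule.add_mem_iff_left P (hpair _ _ (by ring) (by omega)).2,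
      show -1 - (-1 - n) = n by ring, show 2 * n + 1 + (-1 - n) = n by ring] at h0
    exact word_mem_of_perm hu hP hperm hs hd h0
  · have h0 := mem_of_finsum_mem hfin hmem n.toNat (fun i hi =>
      add_mem (hpair _ _ (by ring) (by omega)).1 (hpair _ _ (by ring) (by omega)).2)
    have hc : ((n.toNat : ℕ) : ℤ) = n := by omega
    rw [hc, Submodule.add_mem_iff_right P (hpair _ _ (by ring) (by omega)).1,
      show 2 * n + 1 - 1 - n = n by ring] at h0
    exact word_mem_of_perm hu hP (hperm.trans (List.Perm.swap _ _ _)) hs hd h0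

lemma gen_mem_words (hu : ∀ k, u k ∈ W.grading (wt k))
    (hspan : ∀ r : ℤ, 1 ≤ r → ∀ v ∈ W.grading r,
      v ∈ Submodule.span ℂ {x | ∃ k, wt k = r ∧ u k = x} ⊔ W.C2graded r)
    {s d : ℤ} {x : M} (hx : Gen W Mod w s d x) :
    x ∈ Submodule.span ℂ {y | ∃ L : List (ι × ℤ), wordWt wt L = s ∧ wordDeg wt L = d ∧
      word Mod w u L = y} ⊔ filt W Mod w (s - 1) d := by
  induction hx with
  | base => exact Submodule.mem_sup_left (Submodule.subset_span ⟨[], rfl, rfl, rfl⟩)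
  | @step s d x r v hv n hx ih =>
    rcases lt_trichotomy r 0 with hr | rfl | hr
    · rw [W.neg_bot r hr, Submodule.mem_bot] at hv
      rw [hv, Mod.mmode_zero]
      exact zero_mem _
    · rw [W.cft, Submodule.mem_span_singleton] at hv
      obtain ⟨c, rfl⟩ := hv
      rw [Mod.mmode_smul, Mod.vac_mode]
      split_ifs with hn
      · subst hn
        simpa using Submodule.smul_mem _ c ih
      · simp
    · obtain ⟨x₁, hx₁, x₂, hx₂, rfl⟩ := Submodule.mem_sup.1 ih
      rw [map_add]
      refine add_mem ?_ (Submodule.mem_sup_right (filt_mono (mmode_mem_filt hv n hx₂)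
        (by omega) rfl))
      clear hx ih
      induction hx₁ using Submodule.span_induction with
      | zero => rw [map_zero]; exact zero_mem _
      | add x y _ _ hx hy => rw [map_add]; exact add_mem hx hy
      | smul c x _ hx => rw [map_smul]; exact Submodule.smul_mem _ _ hx
      | mem x hx =>
        obtain ⟨L, rfl, rfl, rfl⟩ := hx
        refine mmode_word_mem hu hspan hr hv n L le_sup_right fun k hk => ?_
        refine Submodule.mem_sup_left (Submodule.subset_span ⟨_, ?_, ?_, rfl⟩)
        · rw [wordWt_cons]; dsimp only; omega
        · rw [wordDeg_cons]; dsimp only; omega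

/-- The spanning theorem: products of modes applied to `w` are combinations of words with distinct
bounded indices. -/
lemma gen_mem_normal (hu : ∀ k, u k ∈ W.grading (wt k)) (hwt : ∀ k, 1 ≤ wt k)
    (hspan : ∀ r : ℤ, 1 ≤ r → ∀ v ∈ W.grading r,
      v ∈ Submodule.span ℂ {x | ∃ k, wt k = r ∧ u k = x} ⊔ W.C2graded r)
    {N : ℤ} (hN : ∀ k, ∀ n : ℤ, N ≤ n → Mod.mmode (u k) n w = 0)
    {s d : ℤ} {x : M} (hx : Gen W Mod w s d x) :
    x ∈ Submodule.span ℂ (word Mod w u '' {L | wordDeg wt L = d ∧ (∀ p ∈ L, p.2 < N) ∧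
      (L.map Prod.snd).Nodup}) := by
  set P := Submodule.span ℂ (word Mod w u '' {L | wordDeg wt L = d ∧ (∀ p ∈ L, p.2 < N) ∧
      (L.map Prod.snd).Nodup}) with hPdef
  have key : ∀ t : ℕ, filt W Mod w ((t : ℤ) - 1) d ≤ P := by
    intro t
    induction t with
    | zero => rw [filt_eq_bot (by norm_num)]; exact bot_le
    | succ t ih =>
      refine Submodule.span_le.2 ?_
      rintro y ⟨s', hs', hy⟩
      push_cast at hs'
      rcases lt_or_ge s' t with h | h
      · exact ih (Submodule.subset_span ⟨s', by omega, hy⟩)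
      obtain rfl : s' = t := by omega
      refine (sup_le ?_ ih : _ ≤ P) (gen_mem_words hu hspan hy)
      rw [Submodule.span_le]
      rintro _ ⟨L, hs, hd, rfl⟩
      exact word_mem_of_normal hu hwt hspan hN ih
        (fun L h1 h2 h3 => Submodule.subset_span ⟨L, ⟨h1, h2, h3⟩, rfl⟩) L hs hd
  refine key (s + 1).toNat (Submodule.subset_span ⟨s, ?_, hx⟩)
  omega

lemma sum_le_sum_Ico {N : ℤ} {T : Finset ℤ} (hT : ∀ n ∈ T, n < N) :
    ∑ n ∈ T, n ≤ ∑ n ∈ Finset.Ico 0 N, n := by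
  calc ∑ n ∈ T, n ≤ ∑ n ∈ T with 0 ≤ n, n := by
        rw [← Finset.sum_filter_add_sum_filter_not T (fun n => 0 ≤ n)]
        have : ∑ n ∈ T with ¬ 0 ≤ n, n ≤ 0 := Finset.sum_nonpos fun n hn => by
          have := (Finset.mem_filter.1 hn).2
          omega
        omega
    _ ≤ _ := by
        refine Finset.sum_le_sum_of_subset_of_nonneg (fun n hn => ?_) fun n hn _ => ?_
        · rw [Finset.mem_filter] at hn
          exact Finset.mem_Ico.2 ⟨hn.2, hT n hn.1⟩
        · exact (Finset.mem_Ico.1 hn).1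

lemma neg_wordDeg_le (hwt : ∀ k, 1 ≤ wt k) (L : List (ι × ℤ)) :
    -wordDeg wt L ≤ (L.map Prod.snd).sum := by
  induction L with
  | nil => simp [wordDeg]
  | cons p L ih =>
    have := hwt p.1
    simp only [wordDeg_cons, List.map_cons, List.sum_cons]
    omega

lemma neg_wordDeg_le_of_normal (hwt : ∀ k, 1 ≤ wt k) {N : ℤ} {L : List (ι × ℤ)}
    (hL : ∀ p ∈ L, p.2 < N) (hnd : (L.map Prod.snd).Nodup) :
    -wordDeg wt L ≤ ∑ n ∈ Finset.Ico 0 N, n ∧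
    ∀ p ∈ L, -wordDeg wt L ≤ p.2 + ∑ n ∈ Finset.Ico 0 N, n := by
  classical
  have h1 := neg_wordDeg_le hwt L
  have h2 : (L.map Prod.snd).sum = ∑ n ∈ (L.map Prod.snd).toFinset, n := by
    rw [List.sum_toFinset _ hnd, List.map_id']
  have hT : ∀ n ∈ (L.map Prod.snd).toFinset, n < N := by
    intro n hn
    obtain ⟨p, hp, rfl⟩ := List.mem_map.1 (List.mem_toFinset.1 hn)
    exact hL p hp
  rw [h2] at h1
  refine ⟨h1.trans (sum_le_sum_Ico hT), fun p hp => ?_⟩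
  rw [← Finset.add_sum_erase _ _ (List.mem_toFinset.2 (List.mem_map_of_mem hp))] at h1
  have h3 := sum_le_sum_Ico (T := (L.map Prod.snd).toFinset.erase p.2)
    fun n hn => hT n (Finset.mem_of_mem_erase hn)
  exact h1.trans (by linarith)

lemma finite_normal [Finite ι] (hwt : ∀ k, 1 ≤ wt k) (N d : ℤ) :
    {L : List (ι × ℤ) | wordDeg wt L = d ∧ (∀ p ∈ L, p.2 < N) ∧
      (L.map Prod.snd).Nodup}.Finite := by
  classical
  set C := ∑ n ∈ Finset.Ico 0 N, n
  have hA : (Set.univ ×ˢ Set.Ico (-d - C) N : Set (ι × ℤ)).Finite :=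
    Set.finite_univ.prod (Set.finite_Ico _ _)
  have hfin : {l : List hA.toFinset | l.length ≤ hA.toFinset.card}.Finite :=
    List.finite_length_le _ _
  refine (hfin.image (List.map Subtype.val)).subset ?_
  rintro L ⟨hd, hL, hnd⟩
  have hmem : ∀ p ∈ L, p ∈ hA.toFinset := by
    intro p hp
    have := (neg_wordDeg_le_of_normal hwt hL hnd).2 p hp
    rw [Set.Finite.mem_toFinset]
    refine ⟨trivial, ?_, hL p hp⟩
    rw [hd] at this
    change -d - C ≤ p.2
    linarith
  obtain ⟨L, rfl⟩ := CanLift.prf (β := List hA.toFinset) L hmem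
  refine ⟨L, ?_, rfl⟩
  have hndL : L.Nodup := (hnd.of_map _).of_map _
  simpa using hndL.length_le_card

end Words

section Generated

variable (W : VOA V) {M : Type} [AddCommGroup M] [Module ℂ M]
  (Mod : WeakMod V W.toVertexAlg M) (w : M)

/-- The degree `d` part of the submodule generated by `w`. -/
def genDeg (d : ℤ) : Submodule ℂ M := Submodule.span ℂ {x | ∃ s, Gen W Mod w s d x}

variable {W Mod w}

lemma self_mem_genDeg : w ∈ genDeg W Mod w 0 := Submodule.subset_span ⟨0, Gen.base⟩

lemma mmode_mem_genDeg {r : ℤ} {v : V} (hv : v ∈ W.grading r) (n : ℤ) {d : ℤ} {x : M}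
    (hx : x ∈ genDeg W Mod w d) : Mod.mmode v n x ∈ genDeg W Mod w (d + r - n - 1) := by
  induction hx using Submodule.span_induction with
  | zero => simp
  | add x y _ _ hx hy => rw [map_add]; exact add_mem hx hy
  | smul c x _ hx => rw [map_smul]; exact Submodule.smul_mem _ _ hx
  | mem x hx =>
    obtain ⟨s, hx⟩ := hx
    exact Submodule.subset_span ⟨s + r, hx.step r v hv n⟩

lemma L0_mem_genDeg {d : ℤ} {x : M} (hx : x ∈ genDeg W Mod w d) :
    Mod.mmode W.ω 1 x ∈ genDeg W Mod w d := by
  have := mmode_mem_genDeg W.ω_grade 1 hx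
  rwa [show d + 2 - 1 - 1 = d by ring] at this

/-- Over a `C₂`-cofinite vertex operator algebra, a singly generated weak module has
finite-dimensional homogeneous parts, and they vanish in very negative degrees. -/
lemma genDeg_finite (h : FiniteDimensional ℂ (V ⧸ Cspace V W.toVertexAlg 2)) (w : M) :
    (∀ d, FiniteDimensional ℂ (genDeg W Mod w d)) ∧ ∃ C : ℤ, ∀ d < C, genDeg W Mod w d = ⊥ := by
  obtain ⟨ι, _, u, wt, hu, hwt, hspan⟩ := W.exists_generators h
  choose f hf using fun k => Mod.trunc (u k) w
  obtain ⟨N, hNf⟩ := (Set.finite_range f).bddAbove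
  have hN : ∀ k, ∀ n : ℤ, N ≤ n → Mod.mmode (u k) n w = 0 := fun k n hn =>
    hf k n ((hNf ⟨k, rfl⟩).trans hn)
  have hle : ∀ d, genDeg W Mod w d ≤ Submodule.span ℂ (word Mod w u '' {L | wordDeg wt L = d ∧
      (∀ p ∈ L, p.2 < N) ∧ (L.map Prod.snd).Nodup}) := by
    intro d
    refine Submodule.span_le.2 ?_
    rintro x ⟨s, hx⟩
    exact gen_mem_normal hu hwt hspan hN hx
  refine ⟨fun d => ?_, -∑ n ∈ Finset.Ico 0 N, n, fun d hd => ?_⟩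
  · have := FiniteDimensional.span_of_finite ℂ ((finite_normal hwt N d).image (word Mod w u))
    exact Submodule.finiteDimensional_of_le (hle d)
  · rw [eq_bot_iff]
    refine (hle d).trans ?_
    rw [Submodule.span_le]
    rintro _ ⟨L, ⟨rfl, hL, hnd⟩, rfl⟩
    have := (neg_wordDeg_le_of_normal hwt hL hnd).1
    omega

end Generated

section Uniform

variable {A : VertexAlg V} {M : Type} [AddCommGroup M] [Module ℂ M] (Mod : WeakMod V A M)
  (I : Type)

/-- The families in `M` that are uniformly truncated by every vector of `V`. -/
def uniformFamilies : Submodule ℂ (I → M) where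
  carrier := {x | ∀ v : V, ∃ N : ℤ, ∀ n : ℤ, N ≤ n → ∀ i, Mod.mmode v n (x i) = 0}
  zero_mem' := fun v => ⟨0, fun n _ i => map_zero _⟩
  add_mem' := by
    intro x y hx hy v
    obtain ⟨N₁, h₁⟩ := hx v
    obtain ⟨N₂, h₂⟩ := hy v
    refine ⟨max N₁ N₂, fun n hn i => ?_⟩
    rw [Pi.add_apply, map_add, h₁ n (by omega) i, h₂ n (by omega) i, add_zero]
  smul_mem' := by
    intro c x hx v
    obtain ⟨N, h⟩ := hx v
    refine ⟨N, fun n hn i => ?_⟩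
    rw [Pi.smul_apply, map_smul, h n hn i, smul_zero]

variable {I}

lemma mmode_mem_uniformFamilies {x : I → M} (hx : x ∈ uniformFamilies Mod I) (a : V) (m : ℤ) :
    (fun i => Mod.mmode a m (x i)) ∈ uniformFamilies Mod I := by
  intro b
  obtain ⟨N, hN⟩ := hx b
  obtain ⟨J, hJ⟩ := A.trunc b a
  choose K hK using fun j : ℕ => hx (A.mode b j a)
  obtain ⟨B, hB⟩ := ((Set.finite_lt_nat J.toNat).image fun j : ℕ => K j + j - m).bddAbove
  refine ⟨max N B, fun n hn i => ?_⟩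
  have h := Mod.commutator b a n m (x i)
  rw [hN n (by omega) i, map_zero, sub_zero] at h
  rw [h]
  refine finsum_eq_zero_of_forall_eq_zero fun j => ?_
  rcases lt_or_ge j J.toNat with hj | hj
  · have : K j + j - m ≤ B := hB ⟨j, hj, rfl⟩
    rw [hK j _ (by omega) i, smul_zero]
  · rw [hJ j (by omega), Mod.mmode_zero, smul_zero]

/-- The componentwise modes on uniformly truncated families. -/
def uniformMode (Mod : WeakMod V A M) (I : Type) :
    V →ₗ[ℂ] ℤ → Module.End ℂ (uniformFamilies Mod I) where
  toFun v n :=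
    { toFun := fun x => ⟨fun i => Mod.mmode v n (x.1 i), mmode_mem_uniformFamilies Mod x.2 v n⟩
      map_add' := fun _ _ => Subtype.ext (funext fun _ => map_add _ _ _)
      map_smul' := fun _ _ => Subtype.ext (funext fun _ => map_smul _ _ _) }
  map_add' u v := funext fun n => LinearMap.ext fun x =>
    Subtype.ext (funext fun i => Mod.mmode_add u v n (x.1 i))
  map_smul' c v := funext fun n => LinearMap.ext fun x =>
    Subtype.ext (funext fun i => Mod.mmode_smul c v n (x.1 i))

lemma uniformMode_trunc (v : V) (x : uniformFamilies Mod I) :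
    ∃ N : ℤ, ∀ n : ℤ, N ≤ n → uniformMode Mod I v n x = 0 := by
  obtain ⟨N, hN⟩ := x.2 v
  exact ⟨N, fun n hn => Subtype.ext (funext fun i => hN n hn i)⟩

/-- Uniformly truncated families form a weak module. -/
def uniformMod (Mod : WeakMod V A M) (I : Type) : WeakMod V A (uniformFamilies Mod I) where
  mmode := uniformMode Mod I
  trunc := uniformMode_trunc Mod
  vac_mode := fun n x => by
    refine Subtype.ext (funext fun i => ?_)
    refine (Mod.vac_mode n (x.1 i)).trans ?_
    split_ifs <;> rfl
  borcherds := fun u v x p q m => by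
    refine Subtype.ext (funext fun i => ?_)
    let ev : uniformFamilies Mod I →ₗ[ℂ] M :=
      (LinearMap.proj i) ∘ₗ (uniformFamilies Mod I).subtype
    change ev _ = ev _
    rw [map_finsum ev, map_finsum ev]
    · simp only [map_zsmul, map_sub]
      exact Mod.borcherds u v (x.1 i) p q m
    · obtain ⟨N₁, hN₁⟩ := uniformMode_trunc Mod v x
      obtain ⟨N₂, hN₂⟩ := uniformMode_trunc Mod u x
      refine WeakMod.finite_support_nat (max (N₁ - q) (N₂ - m)) fun j hj => ?_
      rw [hN₁ _ (by omega), hN₂ _ (by omega), map_zero, map_zero, smul_zero, sub_zero, smul_zero]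
    · obtain ⟨N, hN⟩ := A.trunc u v
      refine WeakMod.finite_support_nat (N - p) fun j hj => ?_
      rw [hN _ (by omega), map_zero, Pi.zero_apply, LinearMap.zero_apply, smul_zero]

end Uniform

section Spectrum

variable {W : VOA V} {M : Type} [AddCommGroup M] [Module ℂ M]
  (Mod : WeakMod V W.toVertexAlg M)

open Module.End

lemma mmode_mem_maxGenEigenspace {r : ℤ} {v : V} (hv : v ∈ W.grading r) (n : ℤ) {μ : ℂ} {x : M}
    (hx : x ∈ maxGenEigenspace (Mod.mmode W.ω 1) μ) :
    Mod.mmode v n x ∈ maxGenEigenspace (Mod.mmode W.ω 1) (μ + (r - n - 1 : ℤ)) := by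
  rw [mem_maxGenEigenspace] at hx ⊢
  obtain ⟨k, hk⟩ := hx
  refine ⟨k, ?_⟩
  have key : ∀ (k : ℕ) (x : M),
      ((Mod.mmode W.ω 1 - (μ + (r - n - 1 : ℤ)) • (1 : Module.End ℂ M)) ^ k) (Mod.mmode v n x)
        = Mod.mmode v n (((Mod.mmode W.ω 1 - μ • (1 : Module.End ℂ M)) ^ k) x) := by
    intro k
    induction k with
    | zero => intro x; rfl
    | succ k ih =>
      intro x
      rw [pow_succ, pow_succ, Module.End.mul_apply, Module.End.mul_apply, ← ih]
      congr 1
      simp only [LinearMap.sub_apply, LinearMap.smul_apply, Module.End.one_apply, map_sub,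
        map_smul, W.L0_mmode Mod hv, add_smul, LinearMap.add_apply]
      abel
  rw [key, hk, map_zero]

lemma genDeg_le_maxGenEigenspace {μ : ℂ} {x : M}
    (hx : x ∈ maxGenEigenspace (Mod.mmode W.ω 1) μ) (d : ℤ) :
    genDeg W Mod x d ≤ maxGenEigenspace (Mod.mmode W.ω 1) (μ + d) := by
  refine Submodule.span_le.2 ?_
  rintro y ⟨s, hy⟩
  induction hy with
  | base => simpa using hx
  | @step s d y r v hv n _ ih =>
    have := mmode_mem_maxGenEigenspace Mod hv n ih
    rwa [add_assoc, ← Int.cast_add, show d + (r - n - 1) = d + r - n - 1 by ring] at this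

/-- `L(0)` is locally finite on every weak module. -/
lemma iSup_maxGenEigenspace_L0 (h : FiniteDimensional ℂ (V ⧸ Cspace V W.toVertexAlg 2)) :
    ⨆ μ, maxGenEigenspace (Mod.mmode W.ω 1) μ = ⊤ := by
  rw [eq_top_iff]
  intro x _
  have := (genDeg_finite (W := W) (Mod := Mod) h x).1 0
  set p := genDeg W Mod x 0
  have hp : ∀ y ∈ p, Mod.mmode W.ω 1 y ∈ p := fun y hy => L0_mem_genDeg hy
  have htop := iSup_maxGenEigenspace_eq_top ((Mod.mmode W.ω 1).restrict hp)
  have hx : (⟨x, self_mem_genDeg⟩ : p) ∈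
      ⨆ μ, maxGenEigenspace ((Mod.mmode W.ω 1).restrict hp) μ := by rw [htop]; trivial
  have hmap := Submodule.mem_map_of_mem (f := p.subtype) hx
  rw [Submodule.map_iSup] at hmap
  refine (iSup_mono fun μ => ?_ : _ ≤ ⨆ μ, maxGenEigenspace (Mod.mmode W.ω 1) μ) hmap
  rw [maxGenEigenspace, genEigenspace_restrict]
  exact Submodule.map_comap_le _ _

/-- The `L(0)`-eigenvalues of lowest weight vectors. -/
def lowestWeights : Set ℂ :=
  {c | ∃ y : M, y ≠ 0 ∧ Mod.mmode W.ω 1 y = c • y ∧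
    ∀ r : ℤ, ∀ v ∈ W.grading r, ∀ n : ℤ, r ≤ n → Mod.mmode v n y = 0}

lemma exists_lowestWeight (h : FiniteDimensional ℂ (V ⧸ Cspace V W.toVertexAlg 2)) {μ : ℂ}
    (hμ : maxGenEigenspace (Mod.mmode W.ω 1) μ ≠ ⊥) :
    ∃ k : ℕ, μ - k ∈ lowestWeights Mod := by
  obtain ⟨x, hx, hx0⟩ := Submodule.exists_mem_ne_zero_of_ne_bot hμ
  obtain ⟨hfd, C, hC⟩ := genDeg_finite (W := W) (Mod := Mod) h x
  have h0 : genDeg W Mod x 0 ≠ ⊥ := fun hb => hx0 (by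
    have := self_mem_genDeg (W := W) (Mod := Mod) (w := x)
    rwa [hb, Submodule.mem_bot] at this)
  obtain ⟨d, hd, hmin⟩ := Int.exists_least_of_bdd (P := fun d => genDeg W Mod x d ≠ ⊥)
    ⟨C, fun d hd => not_lt.1 fun hlt => hd (hC d hlt)⟩ ⟨0, h0⟩
  have hd0 := hmin 0 h0
  have := hfd d
  have : Nontrivial (genDeg W Mod x d) := Submodule.nontrivial_iff_ne_bot.2 hd
  have hp : ∀ y ∈ genDeg W Mod x d, Mod.mmode W.ω 1 y ∈ genDeg W Mod x d :=
    fun y hy => L0_mem_genDeg hy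
  obtain ⟨c, hc⟩ := exists_eigenvalue ((Mod.mmode W.ω 1).restrict hp)
  obtain ⟨y, hy⟩ := hc.exists_hasEigenvector
  have hyc : Mod.mmode W.ω 1 y = c • (y : M) := congrArg Subtype.val hy.apply_eq_smul
  have hy0 : (y : M) ≠ 0 := fun h0 => hy.2 (Subtype.ext h0)
  have hcd : c = μ + d := by
    by_contra hne
    have hdis := (independent_maxGenEigenspace (Mod.mmode W.ω 1)).pairwiseDisjoint hne
    exact hy0 (Submodule.disjoint_def.1 hdis y
      (eigenspace_le_maxGenEigenspace (mem_eigenspace_iff.2 hyc))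
      (genDeg_le_maxGenEigenspace Mod hx d y.2))
  refine ⟨(-d).toNat, y, hy0, ?_, fun r v hv n hn => ?_⟩
  · rw [hyc, hcd]
    have hcast : (((-d).toNat : ℕ) : ℂ) = ((-d : ℤ) : ℂ) := by
      rw [← Int.cast_natCast, Int.toNat_of_nonneg (by omega)]
    rw [hcast]
    push_cast
    rw [sub_neg_eq_add]
  · have hm := mmode_mem_genDeg hv n y.2
    have hb : genDeg W Mod x (d + r - n - 1) = ⊥ := by
      by_contra hb
      have := hmin _ hb
      omega
    rwa [hb, Submodule.mem_bot] at hm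

lemma finite_lowestWeights (h : FiniteDimensional ℂ (V ⧸ Cspace V W.toVertexAlg 2)) :
    (lowestWeights Mod).Finite := by
  choose y hy0 hyc hyl using fun c : lowestWeights Mod => c.2
  have hy : y ∈ uniformFamilies Mod (lowestWeights Mod) := by
    refine W.homogeneous_induction ⟨0, fun n _ i => Mod.mmode_zero _ _⟩ ?_
      fun r v hv => ⟨r, fun n hn i => hyl i r v hv n hn⟩
    rintro u v ⟨N₁, h₁⟩ ⟨N₂, h₂⟩
    refine ⟨max N₁ N₂, fun n hn i => ?_⟩
    rw [Mod.mmode_add, h₁ n (by omega), h₂ n (by omega), add_zero]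
  have hmem : (⟨y, hy⟩ : uniformFamilies Mod (lowestWeights Mod)) ∈
      ⨆ μ, maxGenEigenspace ((uniformMod Mod (lowestWeights Mod)).mmode W.ω 1) μ := by
    rw [iSup_maxGenEigenspace_L0 _ h]; trivial
  obtain ⟨s, hs⟩ := Submodule.mem_iSup_iff_exists_finset.1 hmem
  refine s.finite_toSet.subset fun c hc => ?_
  by_contra hcs
  let ev : uniformFamilies Mod (lowestWeights Mod) →ₗ[ℂ] M :=
    (LinearMap.proj ⟨c, hc⟩) ∘ₗ (uniformFamilies Mod (lowestWeights Mod)).subtype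
  have hev : ∀ μ, maxGenEigenspace ((uniformMod Mod (lowestWeights Mod)).mmode W.ω 1) μ
      ≤ (maxGenEigenspace (Mod.mmode W.ω 1) μ).comap ev := by
    intro μ x hx
    rw [Submodule.mem_comap, mem_maxGenEigenspace]
    rw [mem_maxGenEigenspace] at hx
    obtain ⟨k, hk⟩ := hx
    refine ⟨k, ?_⟩
    have key : ∀ (k : ℕ) x, ((Mod.mmode W.ω 1 - μ • (1 : Module.End ℂ M)) ^ k) (ev x)
        = ev ((((uniformMod Mod (lowestWeights Mod)).mmode W.ω 1 - μ • 1) ^ k) x) := by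
      intro k
      induction k with
      | zero => intro x; rfl
      | succ k ih =>
        intro x
        rw [pow_succ, pow_succ, Module.End.mul_apply, Module.End.mul_apply, ← ih]
        rfl
    rw [key, hk, map_zero]
  have h1 : y ⟨c, hc⟩ ∈ ⨆ μ ∈ (s : Set ℂ), maxGenEigenspace (Mod.mmode W.ω 1) μ := by
    have hle : ⨆ μ ∈ s, maxGenEigenspace ((uniformMod Mod (lowestWeights Mod)).mmode W.ω 1) μ
        ≤ (⨆ μ ∈ (s : Set ℂ), maxGenEigenspace (Mod.mmode W.ω 1) μ).comap ev :=
      iSup₂_le fun μ hμ => (hev μ).trans (Submodule.comap_mono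
        (le_iSup₂_of_le μ (Finset.mem_coe.2 hμ) le_rfl))
    exact hle hs
  have hdis := (independent_maxGenEigenspace (Mod.mmode W.ω 1)).disjoint_biSup hcs
  exact hy0 ⟨c, hc⟩ (Submodule.disjoint_def.1 hdis _
    (eigenspace_le_maxGenEigenspace (mem_eigenspace_iff.2 (hyc ⟨c, hc⟩))) h1)

/-- The real parts of the weights of a weak module are bounded below. -/
lemma exists_weight_bound (h : FiniteDimensional ℂ (V ⧸ Cspace V W.toVertexAlg 2)) :
    ∃ C : ℤ, ∀ μ : ℂ, maxGenEigenspace (Mod.mmode W.ω 1) μ ≠ ⊥ → 0 ≤ ⌊μ.re⌋ + C := by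
  obtain ⟨C, hC⟩ := ((finite_lowestWeights Mod h).image fun c => -⌊c.re⌋).bddAbove
  refine ⟨C, fun μ hμ => ?_⟩
  obtain ⟨k, hk⟩ := exists_lowestWeight Mod h hμ
  have := hC ⟨_, hk, rfl⟩
  simp only [Complex.sub_re, Complex.natCast_re, Int.floor_sub_natCast] at this
  omega

theorem exists_nat_grading (h : FiniteDimensional ℂ (V ⧸ Cspace V W.toVertexAlg 2)) :
    ∃ g : ℤ → Submodule ℂ M, DirectSum.IsInternal g ∧ (∀ n : ℤ, n < 0 → g n = ⊥) ∧
      ∀ (r : ℤ) (v : V), v ∈ W.grading r → ∀ (m n : ℤ), ∀ w ∈ g n,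
        Mod.mmode v m w ∈ g (n + r - m - 1) := by
  obtain ⟨C, hC⟩ := exists_weight_bound Mod h
  have hind := independent_maxGenEigenspace (Mod.mmode W.ω 1)
  refine ⟨fun n => ⨆ μ ∈ {μ : ℂ | ⌊μ.re⌋ + C = n}, maxGenEigenspace (Mod.mmode W.ω 1) μ,
    ?_, ?_, ?_⟩
  · refine DirectSum.isInternal_submodule_of_iSupIndep_of_iSup_eq_top (fun n => ?_) ?_
    · refine (hind.disjoint_biSup_biSup (t := {μ : ℂ | ⌊μ.re⌋ + C ≠ n}) ?_).mono_right ?_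
      · exact Set.disjoint_left.2 fun μ h1 h2 => h2 h1
      · refine iSup₂_le fun j hj => iSup₂_le fun μ hμ => le_iSup₂_of_le μ ?_ le_rfl
        exact fun hn => hj (hμ.symm.trans hn)
    · rw [eq_top_iff, ← iSup_maxGenEigenspace_L0 Mod h]
      exact iSup_le fun μ => le_iSup_of_le (⌊μ.re⌋ + C) (le_iSup₂_of_le μ rfl le_rfl)
  · intro n hn
    rw [eq_bot_iff]
    refine iSup₂_le fun μ hμ => ?_
    by_contra hne
    have h1 := hC μ fun hb => hne hb.le
    have h2 : ⌊μ.re⌋ + C = n := hμ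
    omega
  · intro r v hv m n w hw
    have hle : ⨆ μ ∈ {μ : ℂ | ⌊μ.re⌋ + C = n}, maxGenEigenspace (Mod.mmode W.ω 1) μ ≤
        (⨆ μ ∈ {μ : ℂ | ⌊μ.re⌋ + C = n + r - m - 1},
          maxGenEigenspace (Mod.mmode W.ω 1) μ).comap (Mod.mmode v m) := by
      refine iSup₂_le fun μ hμ x hx => ?_
      have hmem := mmode_mem_maxGenEigenspace Mod hv m hx
      refine (le_iSup₂_of_le (μ + (r - m - 1 : ℤ)) ?_ le_rfl :
        maxGenEigenspace (Mod.mmode W.ω 1) (μ + (r - m - 1 : ℤ)) ≤ _) hmem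
      have h2 : ⌊μ.re⌋ + C = n := hμ
      change ⌊(μ + (r - m - 1 : ℤ)).re⌋ + C = n + r - m - 1
      rw [Complex.add_re, Complex.intCast_re, Int.floor_add_intCast]
      omega
    exact hle hw

lemma eigenspace_lower_truncated (h : FiniteDimensional ℂ (V ⧸ Cspace V W.toVertexAlg 2))
    (μ : ℂ) : ∃ N : ℤ, ∀ n : ℤ, n ≤ N → eigenspace (Mod.mmode W.ω 1) (μ + n) = ⊥ := by
  obtain ⟨C, hC⟩ := exists_weight_bound Mod h
  refine ⟨-⌊μ.re⌋ - C - 1, fun n hn => ?_⟩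
  by_contra hne
  have := hC (μ + n) fun hb => hne (eq_bot_iff.2 (eigenspace_le_maxGenEigenspace.trans hb.le))
  rw [Complex.add_re, Complex.intCast_re, Int.floor_add_intCast] at this
  omega

lemma mmode_mem_eigenspace {r : ℤ} {v : V} (hv : v ∈ W.grading r) (n : ℤ) {μ : ℂ} {x : M}
    (hx : x ∈ eigenspace (Mod.mmode W.ω 1) μ) :
    Mod.mmode v n x ∈ eigenspace (Mod.mmode W.ω 1) (μ + (r - n - 1 : ℤ)) := by
  rw [mem_eigenspace_iff] at hx ⊢
  rw [W.L0_mmode Mod hv, hx, map_smul, add_smul]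

lemma genDeg_le_eigenspace {μ : ℂ} {x : M} (hx : x ∈ eigenspace (Mod.mmode W.ω 1) μ) (d : ℤ) :
    genDeg W Mod x d ≤ eigenspace (Mod.mmode W.ω 1) (μ + d) := by
  refine Submodule.span_le.2 ?_
  rintro y ⟨s, hy⟩
  induction hy with
  | base => simpa using hx
  | @step s d y r v hv n _ ih =>
    have := mmode_mem_eigenspace Mod hv n ih
    rwa [add_assoc, ← Int.cast_add, show d + (r - n - 1) = d + r - n - 1 by ring] at this

lemma invariant_iSup_genDeg (w : M) : Invariant V Mod (⨆ d, genDeg W Mod w d) := by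
  intro v n x hx
  revert v
  refine W.homogeneous_induction ?_ ?_ ?_
  · rw [Mod.mmode_zero]; exact zero_mem _
  · intro u v hu hv
    rw [Mod.mmode_add]
    exact add_mem hu hv
  · intro r v hv
    have hle : ⨆ d, genDeg W Mod w d ≤ (⨆ d, genDeg W Mod w d).comap (Mod.mmode v n) :=
      iSup_le fun d y hy => (le_iSup (genDeg W Mod w) (d + r - n - 1)) (mmode_mem_genDeg hv n hy)
    exact hle hx

/-- An irreducible weak module is generated by an `L(0)`-eigenvector. -/
lemma exists_eigenvector_generator (h : FiniteDimensional ℂ (V ⧸ Cspace V W.toVertexAlg 2))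
    (hirr : IsIrreducibleMod V Mod) :
    ∃ (c : ℂ) (w : M), w ∈ eigenspace (Mod.mmode W.ω 1) c ∧ ⨆ d, genDeg W Mod w d = ⊤ := by
  obtain ⟨μ, hμ⟩ : ∃ μ, maxGenEigenspace (Mod.mmode W.ω 1) μ ≠ ⊥ := by
    by_contra! hall
    exact hirr.1 (by rw [← iSup_maxGenEigenspace_L0 Mod h, iSup_eq_bot.2 hall])
  obtain ⟨k, w, hw0, hwc, -⟩ := exists_lowestWeight Mod h hμ
  refine ⟨_, w, mem_eigenspace_iff.2 hwc, (hirr.2 _ (invariant_iSup_genDeg Mod w)).resolve_left ?_⟩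
  intro hb
  have := le_iSup (genDeg W Mod w) 0 self_mem_genDeg
  rw [hb, Submodule.mem_bot] at this
  exact hw0 this

lemma finiteDimensional_eigenspace (h : FiniteDimensional ℂ (V ⧸ Cspace V W.toVertexAlg 2))
    (hirr : IsIrreducibleMod V Mod) (μ : ℂ) :
    FiniteDimensional ℂ (eigenspace (Mod.mmode W.ω 1) μ) := by
  obtain ⟨c, w, hw, htop⟩ := exists_eigenvector_generator Mod h hirr
  have hdis := eigenspaces_iSupIndep (Mod.mmode W.ω 1) μ
  have hgen := genDeg_le_eigenspace Mod hw
  have hmem : ∀ x ∈ eigenspace (Mod.mmode W.ω 1) μ, ∀ A : Submodule ℂ M,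
      A ≤ eigenspace (Mod.mmode W.ω 1) μ →
      (∀ d : ℤ, c + d = μ → genDeg W Mod w d ≤ A) → x ∈ A := by
    intro x hx A hA hdA
    have hxtop : x ∈ A ⊔ ⨆ ν, ⨆ _ : ν ≠ μ, eigenspace (Mod.mmode W.ω 1) ν := by
      have hle : ⨆ d, genDeg W Mod w d ≤
          A ⊔ ⨆ ν, ⨆ _ : ν ≠ μ, eigenspace (Mod.mmode W.ω 1) ν := by
        refine iSup_le fun d => ?_
        by_cases hd : c + d = μ
        · exact (hdA d hd).trans le_sup_left
        · exact (hgen d).trans (le_sup_of_le_right (le_iSup₂_of_le (c + d) hd le_rfl))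
      exact hle (by rw [htop]; trivial)
    obtain ⟨a, ha, b, hb, rfl⟩ := Submodule.mem_sup.1 hxtop
    have hb' := (Submodule.add_mem_iff_right _ (hA ha)).1 hx
    rw [Submodule.disjoint_def.1 hdis b hb' hb, add_zero]
    exact ha
  by_cases hd : ∃ d : ℤ, c + d = μ
  · obtain ⟨d, rfl⟩ := hd
    have := (genDeg_finite (W := W) (Mod := Mod) h w).1 d
    refine Submodule.finiteDimensional_of_le (S₂ := genDeg W Mod w d) fun x hx => ?_
    refine hmem x hx _ (hgen d) fun d' hd' => ?_
    rw [add_right_inj, Int.cast_inj] at hd'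
    rw [hd']
  · refine Submodule.finiteDimensional_of_le (S₂ := (⊥ : Submodule ℂ M)) fun x hx => ?_
    exact hmem x hx _ bot_le fun d hd' => (hd ⟨d, hd'⟩).elim

lemma iSup_eigenspace_L0 (h : FiniteDimensional ℂ (V ⧸ Cspace V W.toVertexAlg 2))
    (hirr : IsIrreducibleMod V Mod) :
    ⨆ μ, eigenspace (Mod.mmode W.ω 1) μ = ⊤ := by
  obtain ⟨c, w, hw, htop⟩ := exists_eigenvector_generator Mod h hirr
  rw [eq_top_iff, ← htop]
  exact iSup_le fun d => (genDeg_le_eigenspace Mod hw d).trans (le_iSup _ (c + d))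

end Spectrum

end Helpers

/-- If `V` is `C_2`-cofinite, every weak module is ℕ-gradable, and every
irreducible weak module is an irreducible ordinary module: its generalized...
(here: its `L(0)`-eigenspaces are finite-dimensional, exhaust the module, and
are lower truncated). -/
theorem stmt15 (W : VOA V)
    (h : FiniteDimensional ℂ (V ⧸ Cspace V W.toVertexAlg 2)) :
    (∀ (M : Type) [AddCommGroup M] [Module ℂ M]
        (Mod : WeakMod V W.toVertexAlg M),
      ∃ g : ℤ → Submodule ℂ M, DirectSum.IsInternal g ∧
        (∀ n : ℤ, n < 0 → g n = ⊥) ∧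
        ∀ (r : ℤ) (v : V), v ∈ W.grading r → ∀ (m n : ℤ), ∀ w ∈ g n,
          Mod.mmode v m w ∈ g (n + r - m - 1)) ∧
    (∀ (M : Type) [AddCommGroup M] [Module ℂ M]
        (Mod : WeakMod V W.toVertexAlg M),
      IsIrreducibleMod V Mod →
        (∀ μ : ℂ, FiniteDimensional ℂ (Module.End.eigenspace (Mod.mmode W.ω 1) μ)) ∧
        (⨆ μ : ℂ, Module.End.eigenspace (Mod.mmode W.ω 1) μ) = ⊤ ∧
        (∀ μ : ℂ, ∃ N : ℤ, ∀ n : ℤ, n ≤ N →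
          Module.End.eigenspace (Mod.mmode W.ω 1) (μ + n) = ⊥)) := by
  exact ⟨fun M _ _ Mod => exists_nat_grading Mod h, fun M _ _ Mod hirr =>
    ⟨finiteDimensional_eigenspace Mod h hirr, iSup_eigenspace_L0 Mod h hirr,
      eigenspace_lower_truncated Mod h⟩⟩

end VOAPaper
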